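/- Each of the following four nets of quadrics in the variables a,b,c,d,e is semi-stable: I_R = span(ac−b², ae−2bd+c², ce−d²) (the balanced ribbon); I_DT = span(ad−b², ae−bd+c², be−d²) (a double twisted cubic with a conic); I_T = span(ad−bc, ae+bd−c², be−cd) (the triple conic with two lines); and I_DL = span(ad, ae+bd−c², be) (two double lines joined by two conics). -/

import Mathlib

open MvPolynomial

/-- The space of polynomials in the five variables `a,b,c,d,e` (indexed `0,…,4`). -/
abbrev Quin : Type := MvPolynomial (Fin 5) ℂ

/-- `m` is (the exponent vector of) a quadratic monomial. -/
def QuadMon (m : Fin 5 →₀ ℕ) : Prop := (m.sum fun _ n => n) = 2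

/-- A net of quadrics: a 3-dimensional space of quadratic forms. -/
def IsNet (Λ : Submodule ℂ Quin) : Prop :=
  Module.finrank ℂ Λ = 3 ∧ ∀ Q ∈ Λ, MvPolynomial.IsHomogeneous Q 2

/-- The `ρ`-weight of a monomial. -/
def wt (ρ : Fin 5 → ℤ) (m : Fin 5 →₀ ℕ) : ℤ := ∑ i, (m i : ℤ) * ρ i

/-- `Λ` is semistable with respect to the weight vector `ρ`: there are three distinct
quadratic monomials with total `ρ`-weight `≥ 0` such that the corresponding coefficient
map `Λ → ℂ³` is bijective. -/
def SemistableWrt (Λ : Submodule ℂ Quin) (ρ : Fin 5 → ℤ) : Prop :=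
  ∃ m1 m2 m3 : Fin 5 →₀ ℕ, m1 ≠ m2 ∧ m1 ≠ m3 ∧ m2 ≠ m3 ∧
    QuadMon m1 ∧ QuadMon m2 ∧ QuadMon m3 ∧
    0 ≤ wt ρ m1 + wt ρ m2 + wt ρ m3 ∧
    Function.Bijective (fun Q : Λ =>
      (![MvPolynomial.coeff m1 (Q : Quin), MvPolynomial.coeff m2 (Q : Quin),
         MvPolynomial.coeff m3 (Q : Quin)] : Fin 3 → ℂ))

/-- The twelve distinguished weight vectors `ρ1,…,ρ12`. -/
def rho : Fin 12 → Fin 5 → ℤ :=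
  ![![1,1,1,1,-4], ![2,2,2,-3,-3], ![3,3,-2,-2,-2], ![4,-1,-1,-1,-1],
    ![3,3,3,-2,-7], ![4,4,-1,-1,-6], ![9,4,-1,-6,-6], ![7,2,2,-3,-8],
    ![12,7,2,-8,-13], ![9,4,-1,-1,-11], ![14,4,-1,-6,-11], ![13,8,3,-7,-17]]

/-- A normalized weight vector: nonincreasing, sums to zero and not identically zero. -/
def IsNormalized (ρ : Fin 5 → ℤ) : Prop :=
  (∀ i j : Fin 5, i ≤ j → ρ j ≤ ρ i) ∧ (∑ i, ρ i) = 0 ∧ ρ ≠ 0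

/-- Linear substitution of variables by the matrix `g`, as a linear map on polynomials. -/
noncomputable def substMap (g : Matrix (Fin 5) (Fin 5) ℂ) : Quin →ₗ[ℂ] Quin :=
  (MvPolynomial.aeval fun i => ∑ j, MvPolynomial.C (g i j) * MvPolynomial.X j).toLinearMap

/-- Semistability of a net (Hilbert–Mumford criterion for `SL(5)`). -/
def Semistable (Λ : Submodule ℂ Quin) : Prop :=
  ∀ (g : Matrix.GeneralLinearGroup (Fin 5) ℂ) (ρ : Fin 5 → ℤ), IsNormalized ρ →
    SemistableWrt (Submodule.map (substMap (g : Matrix (Fin 5) (Fin 5) ℂ)) Λ) ρ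

/-- The symmetric matrix of a quadratic form. -/
noncomputable def quadMatrix (Q : Quin) : Matrix (Fin 5) (Fin 5) ℂ :=
  Matrix.of fun i j =>
    if i = j then MvPolynomial.coeff (Finsupp.single i 2) Q
    else (1/2) * MvPolynomial.coeff (Finsupp.single i 1 + Finsupp.single j 1) Q

/-- The discriminant quintic `det (x·A1 + y·A2 + z·A3)` of a net with basis `Q1,Q2,Q3`. -/
noncomputable def netDisc (Q1 Q2 Q3 : Quin) : MvPolynomial (Fin 3) ℂ :=
  Matrix.det (Matrix.of fun i j : Fin 5 =>
    MvPolynomial.C (quadMatrix Q1 i j) * MvPolynomial.X 0 +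
    MvPolynomial.C (quadMatrix Q2 i j) * MvPolynomial.X 1 +
    MvPolynomial.C (quadMatrix Q3 i j) * MvPolynomial.X 2)

/-- The net lies on a smooth quartic del Pezzo surface. -/
def OnSmoothDelPezzo (Λ : Submodule ℂ Quin) : Prop :=
  ∃ P1 P2 : Quin, P1 ∈ Λ ∧ P2 ∈ Λ ∧ LinearIndependent ℂ ![P1, P2] ∧
    ∀ v : Fin 5 → ℂ, v ≠ 0 → MvPolynomial.eval v P1 = 0 → MvPolynomial.eval v P2 = 0 →
      LinearIndependent ℂ
        ![fun i => MvPolynomial.eval v (MvPolynomial.pderiv i P1),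
          fun i => MvPolynomial.eval v (MvPolynomial.pderiv i P2)]

/-- The first step of a greedy choice: among the entries which do not vanish identically on `V`
there is one of the largest weight. -/
lemma exists_max_entry (ρ : Fin 5 → ℤ) {T : (Fin 3 → ℂ) →ₗ[ℂ] Matrix (Fin 5) (Fin 5) ℂ}
    (hT : Function.Injective T) {V : Submodule ℂ (Fin 3 → ℂ)} (hV : V ≠ ⊥) :
    ∃ v ∈ V, ∃ i j, T v i j ≠ 0 ∧ ∀ x ∈ V, ∀ i' j', T x i' j' ≠ 0 → ρ i' + ρ j' ≤ ρ i + ρ j := by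
  classical
  obtain ⟨x, hx, hx0⟩ := V.ne_bot_iff.1 hV
  let S : Finset (Fin 5 × Fin 5) := {p | ∃ v ∈ V, T v p.1 p.2 ≠ 0}
  have hS : S.Nonempty := by
    by_contra h
    rw [Finset.not_nonempty_iff_eq_empty, Finset.filter_eq_empty_iff] at h
    refine hx0 (hT ?_)
    ext i j
    by_contra h'
    exact h (Finset.mem_univ (i, j)) ⟨x, hx, by simpa using h'⟩
  obtain ⟨p, hp, hmax⟩ := S.exists_max_image (fun p => ρ p.1 + ρ p.2) hS
  obtain ⟨v, hv, hv0⟩ := (Finset.mem_filter.1 hp).2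
  exact ⟨v, hv, p.1, p.2, hv0, fun x hx i' j' h =>
    hmax (i', j') (Finset.mem_filter.2 ⟨Finset.mem_univ _, x, hx, h⟩)⟩

/-- A net of matrices has a basis adapted to the weight filtration: there are three entries which
are coordinates on the net, and a basis `v` such that no entry of `T (v k)` has larger weight
than the `k`-th of these. -/
lemma exists_adapted_basis (ρ : Fin 5 → ℤ) {T : (Fin 3 → ℂ) →ₗ[ℂ] Matrix (Fin 5) (Fin 5) ℂ}
    (hT : Function.Injective T) :
    ∃ (i j : Fin 3 → Fin 5) (v : Matrix (Fin 3) (Fin 3) ℂ), v.det ≠ 0 ∧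
      (∀ k a b, T (v k) a b ≠ 0 → ρ a + ρ b ≤ ρ (i k) + ρ (j k)) ∧
      Function.Bijective fun (x : Fin 3 → ℂ) k => T x (i k) (j k) := by
  let φ : Fin 5 → Fin 5 → (Fin 3 → ℂ) →ₗ[ℂ] ℂ := fun i j => Matrix.entryLinearMap ℂ ℂ i j ∘ₗ T
  have hφ (i j x) : φ i j x = T x i j := rfl
  obtain ⟨v0, -, i0, j0, h0, hmax0⟩ := exists_max_entry ρ hT (V := ⊤) top_ne_bot
  obtain ⟨v1, hv1, i1, j1, h1, hmax1⟩ := exists_max_entry ρ hT (V := LinearMap.ker (φ i0 j0))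
    (LinearMap.ker_ne_bot_of_finrank_lt (by simp))
  obtain ⟨v2, hv2, i2, j2, h2, hmax2⟩ := exists_max_entry ρ hT
    (V := LinearMap.ker ((φ i0 j0).prod (φ i1 j1)))
    (LinearMap.ker_ne_bot_of_finrank_lt (by simp))
  have hv1' : T v1 i0 j0 = 0 := by simpa [hφ] using hv1
  obtain ⟨hv20, hv21⟩ : T v2 i0 j0 = 0 ∧ T v2 i1 j1 = 0 := by simpa [hφ] using hv2
  let v : Fin 3 → Fin 3 → ℂ := ![v0, v1, v2]
  let i : Fin 3 → Fin 5 := ![i0, i1, i2]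
  let j : Fin 3 → Fin 5 := ![j0, j1, j2]
  let Ψ : (Fin 3 → ℂ) →ₗ[ℂ] Fin 3 → ℂ := LinearMap.pi fun k => φ (i k) (j k)
  have hmul : Matrix.of v * (LinearMap.toMatrix' Ψ).transpose =
      Matrix.of fun a b => T (v a) (i b) (j b) := by
    ext a b
    have h : T (v a) (i b) (j b) = (LinearMap.toMatrix' Ψ).mulVec (v a) b := by
      rw [LinearMap.toMatrix'_mulVec]; rfl
    rw [Matrix.of_apply, h, Matrix.mul_apply, Matrix.mulVec, dotProduct]
    exact Finset.sum_congr rfl fun k _ => mul_comm _ _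
  have hne : (Matrix.of v).det * (LinearMap.toMatrix' Ψ).det ≠ 0 := by
    rw [← Matrix.det_transpose (LinearMap.toMatrix' Ψ), ← Matrix.det_mul, hmul,
      Matrix.det_fin_three]
    simp [v, i, j, hv1', hv20, hv21, h0, h1, h2]
  have hinj : Function.Injective Ψ := by
    have hu : IsUnit (LinearMap.toMatrix' Ψ) := by
      rw [Matrix.isUnit_iff_isUnit_det]
      exact (right_ne_zero_of_mul hne).isUnit
    intro x y hxy
    exact Matrix.mulVec_injective_of_isUnit hu (by simpa [LinearMap.toMatrix'_mulVec] using hxy)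
  refine ⟨i, j, Matrix.of v, left_ne_zero_of_mul hne, fun k a b h => ?_, hinj,
    LinearMap.injective_iff_surjective.1 hinj⟩
  fin_cases k
  · exact hmax0 v0 trivial a b h
  · exact hmax1 v1 hv1 a b h
  · exact hmax2 v2 hv2 a b h

/-- The existence part of the Bruhat decomposition: the relative position of the standard flag of
row vanishing conditions and of the flag spanned by the columns of `M` is a permutation. -/
lemma exists_relative_position {n : ℕ} {M : Matrix (Fin n) (Fin n) ℂ} (hM : M.det ≠ 0) :
    ∃ (π : Equiv.Perm (Fin n)) (c : Fin n → Fin n → ℂ), (∀ k j, π k < j → c k j = 0) ∧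
      (∀ k i, i < k → M.mulVec (c k) i = 0) ∧ ∀ k, M.mulVec (c k) k ≠ 0 := by
  classical
  let P (k p : Fin n) : Prop := ∃ c : Fin n → ℂ, (∀ j, p < j → c j = 0) ∧
    (∀ i, i < k → M.mulVec c i = 0) ∧ M.mulVec c k ≠ 0
  have hP (k : Fin n) : ∃ p, P k p ∧ ∀ q, P k q → p ≤ q := by
    have hn : 0 < n := k.pos
    have hMu : IsUnit M.det := hM.isUnit
    have hc : M.mulVec (M⁻¹.mulVec (Pi.single k 1)) = Pi.single k 1 := by
      rw [Matrix.mulVec_mulVec, Matrix.mul_nonsing_inv M hMu, Matrix.one_mulVec]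
    have hne : ({p | P k p} : Finset (Fin n)).Nonempty := by
      refine ⟨⟨n - 1, by omega⟩, ?_⟩
      rw [Finset.mem_filter]
      refine ⟨Finset.mem_univ _, M⁻¹.mulVec (Pi.single k 1), fun j hj => ?_, fun i hi => ?_, ?_⟩
      · have : n - 1 < (j : ℕ) := hj
        omega
      · rw [hc, Pi.single_eq_of_ne hi.ne]
      · rw [hc, Pi.single_eq_same]
        exact one_ne_zero
    obtain ⟨p, hp, hmin⟩ := Finset.exists_min_image _ id hne
    exact ⟨p, (Finset.mem_filter.1 hp).2, fun q hq => hmin q (by simpa using hq)⟩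
  choose π hπ hmin using hP
  choose c hc hc0 hck using hπ
  have hlead (k : Fin n) (d : Fin n → ℂ) (hd : ∀ j, π k ≤ j → d j = 0)
      (hd0 : ∀ i, i < k → M.mulVec d i = 0) : M.mulVec d k = 0 := by
    by_contra hdk
    by_cases h0 : (π k : ℕ) = 0
    · have : d = 0 := funext fun j => hd j (Fin.le_def.2 (by omega))
      simp [this] at hdk
    · have := hmin k ⟨π k - 1, by omega⟩ ⟨d, fun j hj => hd j (by
        have : (π k : ℕ) - 1 < j := hj
        exact Fin.le_def.2 (by omega)), hd0, hdk⟩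
      have : (π k : ℕ) ≤ π k - 1 := this
      omega
  have hcπ (k : Fin n) : c k (π k) ≠ 0 := by
    intro h
    refine hck k (hlead k (c k) (fun j hj => ?_) (hc0 k))
    rcases hj.eq_or_lt with rfl | hj
    · exact h
    · exact hc k j hj
  have hne (k k' : Fin n) (hk : k < k') : π k ≠ π k' := by
    intro h
    let t := c k (π k) / c k' (π k)
    have hmul (i : Fin n) :
        M.mulVec (c k - t • c k') i = M.mulVec (c k) i - t * M.mulVec (c k') i := by
      simp [Matrix.mulVec_sub, Matrix.mulVec_smul]
    refine hck k ?_
    have := hlead k (c k - t • c k') (fun j hj => ?_) fun i hi => ?_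
    · simpa [hmul, hc0 k' k hk] using this
    · rcases hj.eq_or_lt with rfl | hj
      · have : c k' (π k) ≠ 0 := h ▸ hcπ k'
        simp [t, this]
      · simp [hc k j hj, hc k' j (h ▸ hj)]
    · rw [hmul, hc0 k i hi, hc0 k' i (hi.trans hk)]
      simp
  have hinj : Function.Injective π := by
    intro k k' h
    rcases lt_trichotomy k k' with hk | hk | hk
    · exact (hne k k' hk h).elim
    · exact hk
    · exact (hne k' k hk h.symm).elim
  exact ⟨Equiv.ofBijective π (Finite.injective_iff_bijective.1 hinj), c, hc, hc0, hck⟩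

lemma exists_entry_of_dotProduct_ne_zero {n : ℕ} {M : Matrix (Fin n) (Fin n) ℂ} {u v : Fin n → ℂ}
    (h : u ⬝ᵥ M.mulVec v ≠ 0) : ∃ i j, u i ≠ 0 ∧ M i j ≠ 0 ∧ v j ≠ 0 := by
  obtain ⟨i, -, hi⟩ := Finset.exists_ne_zero_of_sum_ne_zero h
  obtain ⟨j, -, hj⟩ := Finset.exists_ne_zero_of_sum_ne_zero
    (right_ne_zero_of_mul hi : ∑ j, M i j * v j ≠ 0)
  exact ⟨i, j, left_ne_zero_of_mul hi, left_ne_zero_of_mul hj, right_ne_zero_of_mul hj⟩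

section HomogeneousForm

variable {n : ℕ} {s : Fin n → ℤ} {A : Matrix (Fin n) (Fin n) ℂ} {t : ℤ}
  {u : Fin n → Fin n → ℂ}

lemma dotProduct_eq_zero_of_weight_lt (hs : StrictAnti s) (hA : ∀ i j, A i j ≠ 0 → s i + s j = t)
    (hu : ∀ k i, i < k → u k i = 0) {i j : Fin n} (hij : s i + s j < t) :
    u i ⬝ᵥ A.mulVec (u j) = 0 := by
  by_contra h
  obtain ⟨a, b, ha, hab, hb⟩ := exists_entry_of_dotProduct_ne_zero h
  have h1 := hs.antitone (not_lt.1 fun h => ha (hu i a h))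
  have h2 := hs.antitone (not_lt.1 fun h => hb (hu j b h))
  have := hA a b hab
  omega

lemma dotProduct_eq_of_weight_eq (hs : StrictAnti s) (hA : ∀ i j, A i j ≠ 0 → s i + s j = t)
    (hu : ∀ k i, i < k → u k i = 0) {i j : Fin n} (hij : s i + s j = t) :
    u i ⬝ᵥ A.mulVec (u j) = u i i * (A i j * u j j) := by
  have key (a b : Fin n) (h : u i a * (A a b * u j b) ≠ 0) : a = i ∧ b = j := by
    have ha := not_lt.1 fun h' => left_ne_zero_of_mul h (hu i a h')
    have hb := not_lt.1 fun h' => right_ne_zero_of_mul (right_ne_zero_of_mul h) (hu j b h')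
    have h1 := hs.antitone ha
    have h2 := hs.antitone hb
    have := hA a b (left_ne_zero_of_mul (right_ne_zero_of_mul h))
    exact ⟨hs.injective (by omega), hs.injective (by omega)⟩
  simp only [dotProduct, Matrix.mulVec, Finset.mul_sum]
  rw [Finset.sum_eq_single i, Finset.sum_eq_single j]
  · intro b _ hb
    by_contra h
    exact hb (key i b h).2
  · simp
  · intro a _ ha
    refine Finset.sum_eq_zero fun b _ => ?_
    by_contra h
    exact ha (key a b h).1
  · simp

end HomogeneousForm

/-- Let `A` be a net of bilinear forms which are homogeneous for a one-parameter subgroup with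
distinct weights `s`, and let the columns of `M` span an arbitrary flag. If the coordinate flags
do not destabilize the net, then neither does the flag of `M`. -/
lemma exists_entries {A : Fin 3 → Matrix (Fin 5) (Fin 5) ℂ} {s : Fin 5 → ℤ} {t : Fin 3 → ℤ}
    (hs : StrictAnti s) (ht : StrictAnti t) (hA : ∀ k i j, A k i j ≠ 0 → s i + s j = t k)
    (hstate : ∀ σ : Fin 5 → ℤ, ∑ i, σ i = 0 → ∃ i j : Fin 3 → Fin 5,
      (∀ k, A k (i k) (j k) ≠ 0) ∧ 0 ≤ ∑ k, (σ (i k) + σ (j k)))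
    {M : Matrix (Fin 5) (Fin 5) ℂ} (hM : M.det ≠ 0)
    {T : (Fin 3 → ℂ) →ₗ[ℂ] Matrix (Fin 5) (Fin 5) ℂ}
    (hT : ∀ x, T x = M.transpose * (∑ k, x k • A k) * M)
    {ρ : Fin 5 → ℤ} (hρ : Antitone ρ) (hsum : ∑ i, ρ i = 0) :
    ∃ i j : Fin 3 → Fin 5, 0 ≤ ∑ k, (ρ (i k) + ρ (j k)) ∧
      Function.Bijective fun (x : Fin 3 → ℂ) k => T x (i k) (j k) := by
  obtain ⟨π, c, hc, hc0, hck⟩ := exists_relative_position hM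
  obtain ⟨i, j, hij, hw⟩ := hstate (ρ ∘ π) (by simpa [Equiv.sum_comp π ρ] using hsum)
  let u : Fin 5 → Fin 5 → ℂ := fun k => M.mulVec (c k)
  let N : Matrix (Fin 3) (Fin 3) ℂ := Matrix.of fun k l => u (i l) ⬝ᵥ (A k).mulVec (u (j l))
  have hweight (k) : s (i k) + s (j k) = t k := hA k _ _ (hij k)
  have hN : N.det ≠ 0 := by
    have hlow (k l : Fin 3) (hkl : k < l) : N k l = 0 :=
      dotProduct_eq_zero_of_weight_lt hs (hA k) hc0 ((hweight l).trans_lt (ht hkl))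
    have hdiag (k : Fin 3) : N k k ≠ 0 := by
      have : N k k = _ := dotProduct_eq_of_weight_eq hs (hA k) hc0 (hweight k)
      rw [this]
      exact mul_ne_zero (hck _) (mul_ne_zero (hij k) (hck _))
    rw [Matrix.det_of_isLowerTriangular N fun k l hkl => hlow k l hkl]
    exact Finset.prod_ne_zero_iff.2 fun k _ => hdiag k
  have hTc (x : Fin 3 → ℂ) (l : Fin 3) :
      c (i l) ⬝ᵥ (T x).mulVec (c (j l)) = ∑ k, x k * N k l := by
    have : c (i l) ⬝ᵥ (T x).mulVec (c (j l)) =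
        u (i l) ⬝ᵥ (∑ k, x k • A k).mulVec (u (j l)) := by
      rw [hT, ← Matrix.mulVec_mulVec, ← Matrix.mulVec_mulVec, Matrix.dotProduct_mulVec,
        Matrix.vecMul_transpose]
    rw [this, Matrix.sum_mulVec, dotProduct_sum]
    simp [N, Matrix.smul_mulVec, dotProduct_smul]
  have hTinj : Function.Injective T := by
    rw [← LinearMap.ker_eq_bot, LinearMap.ker_eq_bot']
    intro x hx
    refine Matrix.eq_zero_of_vecMul_eq_zero hN (funext fun l => ?_)
    have := hTc x l
    rw [hx] at this
    simpa [Matrix.vecMul, dotProduct] using this.symm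
  obtain ⟨i', j', v, hv, hmax, hbij⟩ := exists_adapted_basis ρ hTinj
  refine ⟨i', j', hw.trans ?_, hbij⟩
  have hK : (v * N).det ≠ 0 := by
    rw [Matrix.det_mul]
    exact mul_ne_zero hv hN
  rw [Matrix.det_apply] at hK
  obtain ⟨τ, -, hτ⟩ := Finset.exists_ne_zero_of_sum_ne_zero hK
  have hτ' (l : Fin 3) : (v * N) (τ l) l ≠ 0 := by
    intro h
    have h0 : ∏ i, (v * N) (τ i) i = 0 := Finset.prod_eq_zero (Finset.mem_univ l) h
    exact hτ (by rw [h0, smul_zero])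
  rw [← Equiv.sum_comp τ fun k => ρ (i' k) + ρ (j' k)]
  refine Finset.sum_le_sum fun l _ => ?_
  have h : c (i l) ⬝ᵥ (T (v (τ l))).mulVec (c (j l)) ≠ 0 := by
    rw [hTc]
    exact hτ' l
  obtain ⟨a, b, ha, hab, hb⟩ := exists_entry_of_dotProduct_ne_zero h
  have h1 := hρ (not_lt.1 fun h => ha (hc (i l) a h))
  have h2 := hρ (not_lt.1 fun h => hb (hc (j l) b h))
  have h3 := hmax (τ l) a b hab
  simp only [Function.comp_apply]
  omega

/-- The quadratic form with matrix `A`. -/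
noncomputable def quadForm : Matrix (Fin 5) (Fin 5) ℂ →ₗ[ℂ] Quin where
  toFun A := ∑ i, ∑ j, C (A i j) * (X i * X j)
  map_add' A B := by simp [add_mul, Finset.sum_add_distrib]
  map_smul' t A := by simp [MvPolynomial.smul_eq_C_mul, Finset.mul_sum, mul_assoc]

lemma quadForm_apply (A : Matrix (Fin 5) (Fin 5) ℂ) :
    quadForm A = ∑ i, ∑ j, C (A i j) * (X i * X j) := rfl

lemma sum_sum_sum_sum_comm {ι M : Type*} [Fintype ι] [AddCommMonoid M] (f : ι → ι → ι → ι → M) :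
    ∑ i, ∑ j, ∑ k, ∑ l, f i j k l = ∑ k, ∑ l, ∑ j, ∑ i, f i j k l := by
  simp only [← Fintype.sum_prod_type']
  exact Fintype.sum_equiv ⟨fun p => (p.2.2.1, p.2.2.2, p.2.1, p.1),
    fun p => (p.2.2.2, p.2.2.1, p.1, p.2.1), fun _ => rfl, fun _ => rfl⟩ _ _ fun _ => rfl

lemma substMap_quadForm (g A : Matrix (Fin 5) (Fin 5) ℂ) :
    substMap g (quadForm A) = quadForm (g.transpose * A * g) := by
  have h : substMap g (quadForm A) =
      ∑ i, ∑ j, C (A i j) * ((∑ k, C (g i k) * X k) * ∑ l, C (g j l) * X l) := by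
    simp [substMap, quadForm_apply, MvPolynomial.algebraMap_eq]
  have hprod (i j : Fin 5) :
      (C (A i j) * ((∑ k, C (g i k) * X k) * ∑ l, C (g j l) * X l) : Quin) =
        ∑ k, ∑ l, C (A i j) * (C (g i k) * X k * (C (g j l) * X l)) := by
    rw [Finset.sum_mul_sum, Finset.mul_sum]
    exact Finset.sum_congr rfl fun k _ => Finset.mul_sum _ _ _
  have h' : quadForm (g.transpose * A * g) =
      ∑ k, ∑ l, ∑ j, ∑ i, C (A i j) * (C (g i k) * X k * (C (g j l) * X l)) := by
    simp only [quadForm_apply, Matrix.mul_apply, Matrix.transpose_apply, map_sum, map_mul,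
      Finset.sum_mul]
    refine Finset.sum_congr rfl fun k _ => Finset.sum_congr rfl fun l _ =>
      Finset.sum_congr rfl fun j _ => Finset.sum_congr rfl fun i _ => by ring
  rw [h, h', ← sum_sum_sum_sum_comm]
  exact Finset.sum_congr rfl fun i _ => Finset.sum_congr rfl fun j _ => hprod i j

/-- The exponent vector of `X i * X j`. -/
noncomputable def pairMon (i j : Fin 5) : Fin 5 →₀ ℕ := Finsupp.single i 1 + Finsupp.single j 1

lemma pairMon_eq_iff {i j k l : Fin 5} :
    pairMon k l = pairMon i j ↔ k = i ∧ l = j ∨ k = j ∧ l = i := by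
  rw [pairMon, pairMon, Finsupp.single_add_single_eq_single_add_single one_ne_zero one_ne_zero]
  aesop

lemma coeff_quadForm {A : Matrix (Fin 5) (Fin 5) ℂ} (hA : A.IsSymm) (i j : Fin 5) :
    coeff (pairMon i j) (quadForm A) = (if i = j then 1 else 2) * A i j := by
  have h (k l : Fin 5) : coeff (pairMon i j) (C (A k l) * (X k * X l) : Quin) =
      if k = i ∧ l = j ∨ k = j ∧ l = i then A k l else 0 := by
    rw [X, X, monomial_mul, coeff_C_mul, coeff_monomial]
    change A k l * (if pairMon k l = pairMon i j then 1 * 1 else 0) = _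
    simp [pairMon_eq_iff]
  simp only [quadForm_apply, coeff_sum, h]
  rcases eq_or_ne i j with rfl | hij
  · simp [ite_and]
  · have h' (k l : Fin 5) : (if k = i ∧ l = j ∨ k = j ∧ l = i then A k l else 0) =
        (if k = i ∧ l = j then A k l else 0) + if k = j ∧ l = i then A k l else 0 := by
      by_cases h1 : k = i ∧ l = j
      · have h2 : ¬ (k = j ∧ l = i) := fun h2 => hij (h1.1.symm.trans h2.1)
        simp [h1, hij]
      · simp [h1]
    simp only [h', Finset.sum_add_distrib]
    simp [ite_and, hij, hA.apply, two_mul]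

lemma quadMon_pairMon (i j : Fin 5) : QuadMon (pairMon i j) := by
  rw [QuadMon, pairMon, Finsupp.sum_add_index' (by simp) (by simp)]
  simp

lemma wt_pairMon (ρ : Fin 5 → ℤ) (i j : Fin 5) : wt ρ (pairMon i j) = ρ i + ρ j := by
  simp [wt, pairMon, add_mul, Finset.sum_add_distrib, Finsupp.single_apply]

/-- A net of quadrics which is homogeneous for a one-parameter subgroup with distinct weights is
semistable as soon as it is not destabilized by the coordinate flags. -/
theorem semistable_of_homogeneous {A : Fin 3 → Matrix (Fin 5) (Fin 5) ℂ}
    {s : Fin 5 → ℤ} {t : Fin 3 → ℤ} (hs : StrictAnti s) (ht : StrictAnti t)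
    (hA : ∀ k i j, A k i j ≠ 0 → s i + s j = t k)
    (hstate : ∀ σ : Fin 5 → ℤ, ∑ i, σ i = 0 → ∃ i j : Fin 3 → Fin 5,
      (∀ k, A k (i k) (j k) ≠ 0) ∧ 0 ≤ ∑ k, (σ (i k) + σ (j k)))
    (hA_symm : ∀ k, (A k).IsSymm) :
    Semistable (Submodule.span ℂ (Set.range fun k => quadForm (A k))) := by
  rintro g ρ ⟨hmono, hsum, -⟩
  let M : Matrix (Fin 5) (Fin 5) ℂ := g
  have hM : M.det ≠ 0 := (Matrix.isUnits_det_units g).ne_zero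
  let T : (Fin 3 → ℂ) →ₗ[ℂ] Matrix (Fin 5) (Fin 5) ℂ :=
    Fintype.linearCombination ℂ fun k => M.transpose * A k * M
  have hT (x) : T x = M.transpose * (∑ k, x k • A k) * M := by
    simp [T, Fintype.linearCombination_apply, Finset.mul_sum, Finset.sum_mul]
  have hTs (x) : (T x).IsSymm := by
    rw [hT, Matrix.IsSymm]
    simp [Matrix.transpose_mul, Matrix.transpose_sum, Matrix.mul_assoc, (hA_symm _).eq]
  obtain ⟨i, j, hw, hbij⟩ := exists_entries hs ht hA hstate hM hT hmono hsum
  let f : (Fin 3 → ℂ) →ₗ[ℂ] Quin := quadForm ∘ₗ T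
  have hrange : Submodule.map (substMap M) (Submodule.span ℂ (Set.range fun k => quadForm (A k))) =
      LinearMap.range f := by
    rw [LinearMap.range_comp, Fintype.range_linearCombination, Submodule.map_span,
      Submodule.map_span, ← Set.range_comp, ← Set.range_comp]
    congr 2
    ext1 k
    exact substMap_quadForm M (A k)
  let F : LinearMap.range f → Fin 3 → ℂ := fun Q k => coeff (pairMon (i k) (j k)) (Q : Quin)
  have hcomp : Function.Bijective (F ∘ f.rangeRestrict) := by
    let d : Fin 3 → ℂ := fun k => if i k = j k then 1 else 2
    have hd (k) : d k ≠ 0 := by dsimp only [d]; split_ifs <;> simp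
    have : F ∘ f.rangeRestrict = (fun y k => d k * y k) ∘ fun x k => T x (i k) (j k) := by
      ext x k
      exact coeff_quadForm (hTs x) _ _
    rw [this]
    refine Function.Bijective.comp ⟨fun y z h => ?_, fun z => ⟨fun k => (d k)⁻¹ * z k, ?_⟩⟩ hbij
    · ext k
      exact mul_left_cancel₀ (hd k) (congrFun h k)
    · ext k
      simp [hd]
  have hF : Function.Bijective F := (Function.Bijective.of_comp_iff F
    ⟨hcomp.1.of_comp, f.surjective_rangeRestrict⟩).1 hcomp
  have hne {a b : Fin 3} (hab : a ≠ b) : pairMon (i a) (j a) ≠ pairMon (i b) (j b) := by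
    intro h
    obtain ⟨Q, hQ⟩ := hF.2 (Pi.single a 1)
    have hQab : F Q a = F Q b := congrArg (fun m => coeff m (Q : Quin)) h
    simp [hQ, hab.symm] at hQab
  change SemistableWrt (Submodule.map (substMap M) _) ρ
  rw [hrange]
  refine ⟨_, _, _, hne (a := 0) (b := 1) (by decide), hne (a := 0) (b := 2) (by decide),
    hne (a := 1) (b := 2) (by decide), quadMon_pairMon _ _, quadMon_pairMon _ _,
    quadMon_pairMon _ _, ?_, ?_⟩
  · simp only [wt_pairMon]
    rwa [Fin.sum_univ_three] at hw
  · convert hF using 2 with Q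
    ext k
    fin_cases k <;> rfl

lemma span_eq_span_range_quadForm {Q : Fin 3 → Quin} {A : Fin 3 → Matrix (Fin 5) (Fin 5) ℂ}
    (h : ∀ k, quadForm (A k) = Q k) :
    Submodule.span ℂ {Q 0, Q 1, Q 2} = Submodule.span ℂ (Set.range fun k => quadForm (A k)) := by
  congr 1
  ext q
  simp [Fin.exists_fin_succ, h, eq_comm]

/-- The monomials `ad`, `be` and one of `c²`, `ae`, `bd` have nonnegative total weight. -/
lemma exists_weight_nonneg {A : Fin 3 → Matrix (Fin 5) (Fin 5) ℂ} (h03 : A 0 0 3 ≠ 0)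
    (h22 : A 1 2 2 ≠ 0) (h04 : A 1 0 4 ≠ 0) (h13 : A 1 1 3 ≠ 0) (h14 : A 2 1 4 ≠ 0)
    (σ : Fin 5 → ℤ) (hσ : ∑ i, σ i = 0) : ∃ i j : Fin 3 → Fin 5,
      (∀ k, A k (i k) (j k) ≠ 0) ∧ 0 ≤ ∑ k, (σ (i k) + σ (j k)) := by
  have key (i j : Fin 5) (h : A 1 i j ≠ 0)
      (hw : 0 ≤ σ 0 + σ 3 + (σ i + σ j) + (σ 1 + σ 4)) : ∃ i j : Fin 3 → Fin 5,
      (∀ k, A k (i k) (j k) ≠ 0) ∧ 0 ≤ ∑ k, (σ (i k) + σ (j k)) := by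
    refine ⟨![0, i, 1], ![3, j, 4], fun k => ?_, by simpa [Fin.sum_univ_three] using hw⟩
    fin_cases k <;> assumption
  rw [Fin.sum_univ_five] at hσ
  by_cases h1 : 0 ≤ σ 2
  · exact key 2 2 h22 (by omega)
  by_cases h2 : 0 ≤ σ 0 + σ 3 + (σ 0 + σ 4) + (σ 1 + σ 4)
  · exact key 0 4 h04 h2
  · exact key 1 3 h13 (by omega)

/-- The matrices of the quadrics of the net of the balanced ribbon. -/
noncomputable def balancedRibbon : Fin 3 → Matrix (Fin 5) (Fin 5) ℂ :=
  ![!![0, 0, 1 / 2, 0, 0; 0, -1, 0, 0, 0; 1 / 2, 0, 0, 0, 0; 0, 0, 0, 0, 0; 0, 0, 0, 0, 0],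
    !![0, 0, 0, 0, 1 / 2; 0, 0, 0, -1, 0; 0, 0, 1, 0, 0; 0, -1, 0, 0, 0; 1 / 2, 0, 0, 0, 0],
    !![0, 0, 0, 0, 0; 0, 0, 0, 0, 0; 0, 0, 0, 0, 1 / 2; 0, 0, 0, -1, 0; 0, 0, 1 / 2, 0, 0]]

lemma balancedRibbon_weight_nonneg (σ : Fin 5 → ℤ) (hσ : ∑ i, σ i = 0) :
    ∃ i j : Fin 3 → Fin 5, (∀ k, balancedRibbon k (i k) (j k) ≠ 0) ∧
      0 ≤ ∑ k, (σ (i k) + σ (j k)) := by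
  rw [Fin.sum_univ_five] at hσ
  have h : 0 ≤ σ 0 + σ 2 + (σ 2 + σ 2) + (σ 2 + σ 4) ∨
      0 ≤ σ 1 + σ 1 + (σ 0 + σ 4) + (σ 3 + σ 3) ∨
      0 ≤ σ 1 + σ 1 + (σ 2 + σ 2) + (σ 3 + σ 3) ∨
      0 ≤ σ 0 + σ 2 + (σ 0 + σ 4) + (σ 2 + σ 4) := by
    omega
  rcases h with h | h | h | h
  · exact ⟨![0, 2, 2], ![2, 2, 4], fun k => by fin_cases k <;> simp [balancedRibbon],
      by simpa [Fin.sum_univ_three] using h⟩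
  · exact ⟨![1, 0, 3], ![1, 4, 3], fun k => by fin_cases k <;> simp [balancedRibbon],
      by simpa [Fin.sum_univ_three] using h⟩
  · exact ⟨![1, 2, 3], ![1, 2, 3], fun k => by fin_cases k <;> simp [balancedRibbon],
      by simpa [Fin.sum_univ_three] using h⟩
  · exact ⟨![0, 0, 2], ![2, 4, 4], fun k => by fin_cases k <;> simp [balancedRibbon],
      by simpa [Fin.sum_univ_three] using h⟩

lemma C_inv_two_mul_two : (C 2⁻¹ : Quin) * 2 = 1 := by
  rw [show (2 : Quin) = C 2 from rfl, ← C_mul, inv_mul_cancel₀ two_ne_zero, C_1]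

lemma semistable_balancedRibbon :
    Semistable (Submodule.span ℂ (Set.range fun k => quadForm (balancedRibbon k))) := by
  refine semistable_of_homogeneous (s := ![2, 1, 0, -1, -2]) (t := ![2, 0, -2]) (by decide)
    (by decide)
    (fun k i j h => ?_) (balancedRibbon_weight_nonneg) fun k => ?_
  · fin_cases k <;> fin_cases i <;> fin_cases j <;> first | rfl | exact (h rfl).elim
  · ext i j
    fin_cases k <;> fin_cases i <;> fin_cases j <;> rfl

lemma quadForm_balancedRibbon (k : Fin 3) :
    quadForm (balancedRibbon k) =
      (![X 0 * X 2 - X 1 ^ 2, X 0 * X 4 - 2 * (X 1 * X 3) + X 2 ^ 2,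
        X 2 * X 4 - X 3 ^ 2] : Fin 3 → Quin) k := by
  have h : (C 2⁻¹ : Quin) * 2 = 1 := C_inv_two_mul_two
  fin_cases k
  · simp [quadForm_apply, balancedRibbon, Fin.sum_univ_five, div_eq_mul_inv]
    linear_combination (X 0 * X 2) * h
  · simp [quadForm_apply, balancedRibbon, Fin.sum_univ_five, div_eq_mul_inv]
    linear_combination (X 0 * X 4) * h
  · simp [quadForm_apply, balancedRibbon, Fin.sum_univ_five, div_eq_mul_inv]
    linear_combination (X 2 * X 4) * h

/-- The matrices of the quadrics of the net of the double twisted cubic with a conic. -/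
noncomputable def doubleTwistedCubic : Fin 3 → Matrix (Fin 5) (Fin 5) ℂ :=
  ![!![0, 0, 0, 1 / 2, 0; 0, -1, 0, 0, 0; 0, 0, 0, 0, 0; 1 / 2, 0, 0, 0, 0; 0, 0, 0, 0, 0],
    !![0, 0, 0, 0, 1 / 2; 0, 0, 0, -1 / 2, 0; 0, 0, 1, 0, 0; 0, -1 / 2, 0, 0, 0; 1 / 2, 0, 0, 0, 0],
    !![0, 0, 0, 0, 0; 0, 0, 0, 0, 1 / 2; 0, 0, 0, 0, 0; 0, 0, 0, -1, 0; 0, 1 / 2, 0, 0, 0]]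

lemma semistable_doubleTwistedCubic :
    Semistable (Submodule.span ℂ (Set.range fun k => quadForm (doubleTwistedCubic k))) := by
  refine semistable_of_homogeneous (s := ![3, 1, 0, -1, -3]) (t := ![2, 0, -2]) (by decide)
    (by decide)
    (fun k i j h => ?_) (exists_weight_nonneg ?_ ?_ ?_ ?_ ?_) fun k => ?_
  · fin_cases k <;> fin_cases i <;> fin_cases j <;> first | rfl | exact (h rfl).elim
  iterate 5 · simp [doubleTwistedCubic]
  · ext i j
    fin_cases k <;> fin_cases i <;> fin_cases j <;> rfl

lemma quadForm_doubleTwistedCubic (k : Fin 3) :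
    quadForm (doubleTwistedCubic k) =
      (![X 0 * X 3 - X 1 ^ 2, X 0 * X 4 - X 1 * X 3 + X 2 ^ 2,
        X 1 * X 4 - X 3 ^ 2] : Fin 3 → Quin) k := by
  have h : (C 2⁻¹ : Quin) * 2 = 1 := C_inv_two_mul_two
  fin_cases k
  · simp [quadForm_apply, doubleTwistedCubic, Fin.sum_univ_five, div_eq_mul_inv]
    linear_combination (X 0 * X 3) * h
  · simp [quadForm_apply, doubleTwistedCubic, Fin.sum_univ_five, div_eq_mul_inv]
    linear_combination (X 0 * X 4 - X 1 * X 3) * h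
  · simp [quadForm_apply, doubleTwistedCubic, Fin.sum_univ_five, div_eq_mul_inv]
    linear_combination (X 1 * X 4) * h

/-- The matrices of the quadrics of the net of the triple conic with two lines. -/
noncomputable def tripleConic : Fin 3 → Matrix (Fin 5) (Fin 5) ℂ :=
  ![!![0, 0, 0, 1 / 2, 0; 0, 0, -1 / 2, 0, 0; 0, -1 / 2, 0, 0, 0; 1 / 2, 0, 0, 0, 0; 0, 0, 0, 0, 0],
    !![0, 0, 0, 0, 1 / 2; 0, 0, 0, 1 / 2, 0; 0, 0, -1, 0, 0; 0, 1 / 2, 0, 0, 0; 1 / 2, 0, 0, 0, 0],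
    !![0, 0, 0, 0, 0; 0, 0, 0, 0, 1 / 2; 0, 0, 0, -1 / 2, 0; 0, 0, -1 / 2, 0, 0; 0, 1 / 2, 0, 0, 0]]

lemma semistable_tripleConic :
    Semistable (Submodule.span ℂ (Set.range fun k => quadForm (tripleConic k))) := by
  refine semistable_of_homogeneous (s := ![2, 1, 0, -1, -2]) (t := ![1, 0, -1]) (by decide)
    (by decide)
    (fun k i j h => ?_) (exists_weight_nonneg ?_ ?_ ?_ ?_ ?_) fun k => ?_
  · fin_cases k <;> fin_cases i <;> fin_cases j <;> first | rfl | exact (h rfl).elim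
  iterate 5 · simp [tripleConic]
  · ext i j
    fin_cases k <;> fin_cases i <;> fin_cases j <;> rfl

lemma quadForm_tripleConic (k : Fin 3) :
    quadForm (tripleConic k) =
      (![X 0 * X 3 - X 1 * X 2, X 0 * X 4 + X 1 * X 3 - X 2 ^ 2,
        X 1 * X 4 - X 2 * X 3] : Fin 3 → Quin) k := by
  have h : (C 2⁻¹ : Quin) * 2 = 1 := C_inv_two_mul_two
  fin_cases k
  · simp [quadForm_apply, tripleConic, Fin.sum_univ_five, div_eq_mul_inv]
    linear_combination (X 0 * X 3 - X 1 * X 2) * h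
  · simp [quadForm_apply, tripleConic, Fin.sum_univ_five, div_eq_mul_inv]
    linear_combination (X 0 * X 4 + X 1 * X 3) * h
  · simp [quadForm_apply, tripleConic, Fin.sum_univ_five, div_eq_mul_inv]
    linear_combination (X 1 * X 4 - X 2 * X 3) * h

/-- The matrices of the quadrics of the net of the two double lines joined by two conics. -/
noncomputable def doubleLines : Fin 3 → Matrix (Fin 5) (Fin 5) ℂ :=
  ![!![0, 0, 0, 1 / 2, 0; 0, 0, 0, 0, 0; 0, 0, 0, 0, 0; 1 / 2, 0, 0, 0, 0; 0, 0, 0, 0, 0],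
    !![0, 0, 0, 0, 1 / 2; 0, 0, 0, 1 / 2, 0; 0, 0, -1, 0, 0; 0, 1 / 2, 0, 0, 0; 1 / 2, 0, 0, 0, 0],
    !![0, 0, 0, 0, 0; 0, 0, 0, 0, 1 / 2; 0, 0, 0, 0, 0; 0, 0, 0, 0, 0; 0, 1 / 2, 0, 0, 0]]

lemma semistable_doubleLines :
    Semistable (Submodule.span ℂ (Set.range fun k => quadForm (doubleLines k))) := by
  refine semistable_of_homogeneous (s := ![2, 1, 0, -1, -2]) (t := ![1, 0, -1]) (by decide)
    (by decide)
    (fun k i j h => ?_) (exists_weight_nonneg ?_ ?_ ?_ ?_ ?_) fun k => ?_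
  · fin_cases k <;> fin_cases i <;> fin_cases j <;> first | rfl | exact (h rfl).elim
  iterate 5 · simp [doubleLines]
  · ext i j
    fin_cases k <;> fin_cases i <;> fin_cases j <;> rfl

lemma quadForm_doubleLines (k : Fin 3) :
    quadForm (doubleLines k) =
      (![X 0 * X 3, X 0 * X 4 + X 1 * X 3 - X 2 ^ 2,
        X 1 * X 4] : Fin 3 → Quin) k := by
  have h : (C 2⁻¹ : Quin) * 2 = 1 := C_inv_two_mul_two
  fin_cases k
  · simp [quadForm_apply, doubleLines, Fin.sum_univ_five, div_eq_mul_inv]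
    linear_combination (X 0 * X 3) * h
  · simp [quadForm_apply, doubleLines, Fin.sum_univ_five, div_eq_mul_inv]
    linear_combination (X 0 * X 4 + X 1 * X 3) * h
  · simp [quadForm_apply, doubleLines, Fin.sum_univ_five, div_eq_mul_inv]
    linear_combination (X 1 * X 4) * h

open MvPolynomial in
/-- The balanced ribbon `I_R`, the double twisted cubic `I_DT`, the
triple conic `I_T`, and the two double lines `I_DL` are all semistable nets. -/
theorem four_special_nets_semistable :
    Semistable (Submodule.span ℂ
      {(X 0 * X 2 - X 1 ^ 2 : Quin),
       X 0 * X 4 - 2 * (X 1 * X 3) + X 2 ^ 2,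
       X 2 * X 4 - X 3 ^ 2}) ∧
    Semistable (Submodule.span ℂ
      {(X 0 * X 3 - X 1 ^ 2 : Quin),
       X 0 * X 4 - X 1 * X 3 + X 2 ^ 2,
       X 1 * X 4 - X 3 ^ 2}) ∧
    Semistable (Submodule.span ℂ
      {(X 0 * X 3 - X 1 * X 2 : Quin),
       X 0 * X 4 + X 1 * X 3 - X 2 ^ 2,
       X 1 * X 4 - X 2 * X 3}) ∧
    Semistable (Submodule.span ℂ
      {(X 0 * X 3 : Quin),
       X 0 * X 4 + X 1 * X 3 - X 2 ^ 2,
       X 1 * X 4}) := by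
  exact ⟨span_eq_span_range_quadForm quadForm_balancedRibbon ▸ semistable_balancedRibbon,
    span_eq_span_range_quadForm quadForm_doubleTwistedCubic ▸ semistable_doubleTwistedCubic,
    span_eq_span_range_quadForm quadForm_tripleConic ▸ semistable_tripleConic,
    span_eq_span_range_quadForm quadForm_doubleLines ▸ semistable_doubleLines⟩
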